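/- arXiv:2409.20505 — 2 statements merged into one kernel-verified Lean document; each statement's English description precedes it below -/
import Mathlib

section
/- Let m and n be integers with m, n ≥ 2. For the Closed Geodetic Game on the complete bipartite graph K_{m,n}: if m and n have the same parity then 𝒢(K_{m,n}) = 0, and otherwise 𝒢(K_{m,n}) = 2. -/
open SimpleGraph

/-- mex: least nonnegative integer not in the set. -/
noncomputable def mex (X : Set ℕ) : ℕ := sInf Xᶜ

/-- The interval `I(u,v)`: vertices on some shortest `u`–`v` path. -/
def geodInterval {V : Type*} (G : SimpleGraph V) (u v : V) : Set V :=
  {w | G.dist u w + G.dist w v = G.dist u v}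

/-- The geodetic closure `(S)`. -/
def geodClosure {V : Type*} (G : SimpleGraph V) (S : Set V) : Set V :=
  ⋃ u ∈ S, ⋃ v ∈ S, geodInterval G u v

/-- Sprague–Grundy value of the Closed Geodetic Game on `G` with selected set `S`. -/
noncomputable def grundy {V : Type*} [Fintype V] [DecidableEq V]
    (G : SimpleGraph V) (S : Finset V) : ℕ :=
  mex (Set.range fun v : {v : V // v ∉ geodClosure G ↑S} =>
    grundy G (insert v.1 S))
termination_by Sᶜ.card
decreasing_by
  have hv : (v : V) ∉ S := by
    intro h
    exact v.2 (Set.mem_biUnion (by simpa using h)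
      (Set.mem_biUnion (by simpa using h) (by simp [geodInterval])))
  simp only [Finset.compl_insert]
  exact Finset.card_erase_lt_of_mem (by simpa using hv)

theorem mex_eq_of {X : Set ℕ} {k : ℕ} (hk : k ∉ X) (h : ∀ j < k, j ∈ X) : mex X = k := by
  unfold mex
  refine le_antisymm (Nat.sInf_le hk) (not_lt.1 fun hlt => ?_)
  exact Nat.sInf_mem (s := Xᶜ) ⟨k, hk⟩ (h _ hlt)

theorem mem_geodClosure {V : Type*} {G : SimpleGraph V} {S : Set V} {w : V} :
    w ∈ geodClosure G S ↔ ∃ u ∈ S, ∃ v ∈ S, G.dist u w + G.dist w v = G.dist u v := by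
  simp [geodClosure, geodInterval]

theorem dist_eq_two {V : Type*} {G : SimpleGraph V} {u v w : V} (huv : u ≠ v)
    (hadj : ¬ G.Adj u v) (huw : G.Adj u w) (hwv : G.Adj w v) : G.dist u v = 2 := by
  have hle : G.dist u v ≤ 2 := dist_le (Walk.cons huw (Walk.cons hwv Walk.nil))
  have hreach : G.Reachable u v := huw.reachable.trans hwv.reachable
  have h0 : G.dist u v ≠ 0 := fun h => huv (hreach.dist_eq_zero_iff.1 h)
  have h1 : G.dist u v ≠ 1 := fun h => hadj (dist_eq_one_iff_adj.1 h)
  omega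

section CompleteBipartite

variable {V W : Type*}

theorem dist_completeBipartite_inl_inr (x : V) (y : W) :
    (completeBipartiteGraph V W).dist (.inl x) (.inr y) = 1 :=
  dist_eq_one_iff_adj.2 (by simp)

theorem dist_completeBipartite_inr_inl (x : V) (y : W) :
    (completeBipartiteGraph V W).dist (.inr y) (.inl x) = 1 :=
  dist_eq_one_iff_adj.2 (by simp)

theorem dist_completeBipartite_inl_inl [DecidableEq V] [Nonempty W] (x y : V) :
    (completeBipartiteGraph V W).dist (.inl x) (.inl y) = if x = y then 0 else 2 := by
  split_ifs with h
  · simp [h]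
  · exact dist_eq_two (w := .inr (Classical.arbitrary W)) (by simpa using h)
      (by simp) (by simp) (by simp)

theorem dist_completeBipartite_inr_inr [DecidableEq W] [Nonempty V] (x y : W) :
    (completeBipartiteGraph V W).dist (.inr x) (.inr y) = if x = y then 0 else 2 := by
  split_ifs with h
  · simp [h]
  · exact dist_eq_two (w := .inl (Classical.arbitrary V)) (by simpa using h)
      (by simp) (by simp) (by simp)

theorem inl_mem_geodClosure_completeBipartite [Nonempty V] [Nonempty W]
    (S : Finset (V ⊕ W)) (x : V) :
    .inl x ∈ geodClosure (completeBipartiteGraph V W) (S : Set (V ⊕ W)) ↔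
      x ∈ S.toLeft ∨ 2 ≤ S.toRight.card := by
  classical
  simp only [mem_geodClosure, Sum.exists, dist_completeBipartite_inl_inl,
    dist_completeBipartite_inr_inr, dist_completeBipartite_inl_inr,
    dist_completeBipartite_inr_inl, Finset.mem_coe, ← Finset.mem_toLeft,
    ← Finset.mem_toRight, Nat.succ_le_iff, Finset.one_lt_card]
  grind

theorem inr_mem_geodClosure_completeBipartite [Nonempty V] [Nonempty W]
    (S : Finset (V ⊕ W)) (y : W) :
    .inr y ∈ geodClosure (completeBipartiteGraph V W) (S : Set (V ⊕ W)) ↔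
      y ∈ S.toRight ∨ 2 ≤ S.toLeft.card := by
  classical
  simp only [mem_geodClosure, Sum.exists, dist_completeBipartite_inl_inl,
    dist_completeBipartite_inr_inr, dist_completeBipartite_inl_inr,
    dist_completeBipartite_inr_inl, Finset.mem_coe, ← Finset.mem_toLeft,
    ← Finset.mem_toRight, Nat.succ_le_iff, Finset.one_lt_card]
  grind

end CompleteBipartite

/-- The Grundy value of a position on `K_{m,n}` with `a` vertices selected on the side of size `m`
and `b` on the side of size `n`. -/
def bipartiteValue (m n a b : ℕ) : ℕ :=
  if 2 ≤ a then if 2 ≤ b then 0 else (m - a) % 2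
  else if 2 ≤ b then (n - b) % 2
  else if m % 2 = n % 2 then
    if a = b then if a = 0 then 0 else 1 - m % 2 else 2
  else if a = b then 2
  else if a = 1 then 1 - m % 2 else 1 - n % 2

theorem mex_bipartiteValue {m n a b : ℕ} (hm : 2 ≤ m) (hn : 2 ≤ n) (ha : a ≤ m) (hb : b ≤ n) :
    mex {k | (a < m ∧ b < 2 ∧ k = bipartiteValue m n (a + 1) b) ∨
      (b < n ∧ a < 2 ∧ k = bipartiteValue m n a (b + 1))} = bipartiteValue m n a b := by
  apply mex_eq_of
  · simp only [Set.mem_ofPred_eq]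
    unfold bipartiteValue
    grind
  · intro j hj
    simp only [Set.mem_ofPred_eq]
    unfold bipartiteValue at *
    grind

theorem grundy_completeBipartite_eq_bipartiteValue {m n : ℕ} (hm : 2 ≤ m) (hn : 2 ≤ n)
    (S : Finset (Fin m ⊕ Fin n)) :
    grundy (completeBipartiteGraph (Fin m) (Fin n)) S =
      bipartiteValue m n S.toLeft.card S.toRight.card := by
  have : Nonempty (Fin m) := ⟨⟨0, by omega⟩⟩
  have : Nonempty (Fin n) := ⟨⟨0, by omega⟩⟩
  have hl : ∀ x, x ∉ S.toLeft → grundy (completeBipartiteGraph (Fin m) (Fin n)) (insert (.inl x) S)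
      = bipartiteValue m n (S.toLeft.card + 1) S.toRight.card := by
    intro x hx
    rw [grundy_completeBipartite_eq_bipartiteValue hm hn, Finset.toLeft_insert_inl,
      Finset.toRight_insert_inl, Finset.card_insert_of_notMem hx]
  have hr : ∀ y, y ∉ S.toRight → grundy (completeBipartiteGraph (Fin m) (Fin n))
      (insert (.inr y) S) = bipartiteValue m n S.toLeft.card (S.toRight.card + 1) := by
    intro y hy
    rw [grundy_completeBipartite_eq_bipartiteValue hm hn, Finset.toLeft_insert_inr,
      Finset.toRight_insert_inr, Finset.card_insert_of_notMem hy]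
  have hlm : S.toLeft.card ≤ m := by simpa using S.toLeft.card_le_univ
  have hrn : S.toRight.card ≤ n := by simpa using S.toRight.card_le_univ
  rw [grundy, ← mex_bipartiteValue hm hn hlm hrn]
  congr 1
  ext k
  simp only [Set.mem_range, Subtype.exists, Sum.exists, inl_mem_geodClosure_completeBipartite,
    inr_mem_geodClosure_completeBipartite, Set.mem_ofPred_eq, not_or, not_le, exists_prop]
  have exl : S.toLeft.card < m ↔ ∃ x, x ∉ S.toLeft := by
    simpa [Finset.eq_univ_iff_forall] using Finset.card_lt_iff_ne_univ S.toLeft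
  have exr : S.toRight.card < n ↔ ∃ y, y ∉ S.toRight := by
    simpa [Finset.eq_univ_iff_forall] using Finset.card_lt_iff_ne_univ S.toRight
  rw [exl, exr]
  grind
termination_by Sᶜ.card
decreasing_by
  all_goals
    rw [Finset.compl_insert]
    refine Finset.card_erase_lt_of_mem ?_
    simp_all

/-- for `m, n ≥ 2`, the Grundy value of the Closed Geodetic Game on the
complete bipartite graph `K_{m,n}` is `0` if `m` and `n` have the same parity,
and `2` otherwise. -/
theorem grundy_completeBipartite (m n : ℕ) (hm : 2 ≤ m) (hn : 2 ≤ n) :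
    grundy (completeBipartiteGraph (Fin m) (Fin n)) (∅ : Finset (Fin m ⊕ Fin n)) =
      if m % 2 = n % 2 then 0 else 2 := by
  have hl : (∅ : Finset (Fin m ⊕ Fin n)).toLeft = ∅ := by ext; simp
  have hr : (∅ : Finset (Fin m ⊕ Fin n)).toRight = ∅ := by ext; simp
  simp [hl, hr, grundy_completeBipartite_eq_bipartiteValue hm hn, bipartiteValue]
end

section
/- Let n be a positive integer and let P_n be the path with vertices u_1, …, u_n in order. For all indices 1 ≤ i < j ≤ n, the Closed Geodetic Game position on P_n with u_i and u_j already selected has the same Sprague–Grundy value as the position on the shorter path P_{n−(j−i)} (with vertices u'_1, …, u'_{n−(j−i)} in order) with its i-th vertex u'_i already selected: 𝒢(P_n, {u_i, u_j}) = 𝒢(P_{n−(j−i)}, {u'_i}). -/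
open SimpleGraph

theorem pathGraph_dist_of_le {n : ℕ} {u v : Fin n} (huv : u ≤ v) :
    (pathGraph n).dist u v = v.val - u.val := by
  apply le_antisymm
  · obtain ⟨v, hv⟩ := v
    induction v with
    | zero =>
      obtain rfl : u = ⟨0, hv⟩ := le_antisymm huv (Nat.zero_le _)
      simp
    | succ k ih =>
      rcases huv.eq_or_lt with rfl | hlt
      · simp
      · have hk : u.val ≤ k := Nat.lt_succ_iff.mp hlt
        have hadj : (pathGraph n).Adj ⟨k, by omega⟩ ⟨k + 1, hv⟩ :=
          pathGraph_adj.mpr (Or.inl rfl)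
        have htri := (pathGraph_preconnected n u ⟨k, by omega⟩).dist_triangle_left ⟨k + 1, hv⟩
        rw [dist_eq_one_iff_adj.mpr hadj] at htri
        have := ih (by omega) hk
        dsimp only at this ⊢
        omega
  · have length_ge : ∀ {a b : Fin n} (p : (pathGraph n).Walk a b), b.val - a.val ≤ p.length := by
      intro a b p
      induction p with
      | nil => simp
      | cons h p ih =>
        rw [pathGraph_adj] at h
        rw [Walk.length_cons]
        omega
    obtain ⟨p, hp⟩ := (pathGraph_preconnected n u v).exists_walk_length_eq_dist
    exact hp ▸ length_ge p

theorem pathGraph_dist {n : ℕ} (u v : Fin n) :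
    (pathGraph n).dist u v = (v.val - u.val) + (u.val - v.val) := by
  rcases le_total u v with h | h
  · rw [pathGraph_dist_of_le h]
    omega
  · rw [dist_comm, pathGraph_dist_of_le h]
    omega

theorem geodClosure_pathGraph {n : ℕ} {S : Set (Fin n)} {a b : Fin n}
    (ha : IsLeast S a) (hb : IsGreatest S b) :
    geodClosure (pathGraph n) S = Set.Icc a b := by
  ext w
  simp only [geodClosure, geodInterval, pathGraph_dist, Set.mem_iUnion, Set.mem_ofPred_eq,
    Set.mem_Icc, exists_prop, Fin.le_def]
  constructor
  · rintro ⟨u, hu, v, hv, h⟩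
    have h₁ : a.val ≤ u.val := ha.2 hu
    have h₂ : a.val ≤ v.val := ha.2 hv
    have h₃ : u.val ≤ b.val := hb.2 hu
    have h₄ : v.val ≤ b.val := hb.2 hv
    omega
  · intro h
    exact ⟨a, ha.1, b, hb.1, by omega⟩

/-- A position on a path is determined, up to its Grundy value, by the number of vertices to the
left and to the right of the selected set. -/
theorem grundy_pathGraph_congr {n m : ℕ} {S : Finset (Fin n)} {T : Finset (Fin m)}
    {a b : Fin n} {c d : Fin m}
    (ha : IsLeast (S : Set (Fin n)) a) (hb : IsGreatest (S : Set (Fin n)) b)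
    (hc : IsLeast (T : Set (Fin m)) c) (hd : IsGreatest (T : Set (Fin m)) d)
    (hleft : a.val = c.val) (hright : n - b.val = m - d.val) :
    grundy (pathGraph n) S = grundy (pathGraph m) T := by
  induction hk : a.val + (n - b.val) using Nat.strong_induction_on
    generalizing n m S T a b c d with
  | _ k ih =>
  have options_subset : ∀ {n m : ℕ} {S : Finset (Fin n)} {T : Finset (Fin m)}
      {a b : Fin n} {c d : Fin m},
      IsLeast (S : Set (Fin n)) a → IsGreatest (S : Set (Fin n)) b →
      IsLeast (T : Set (Fin m)) c → IsGreatest (T : Set (Fin m)) d →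
      a.val = c.val → n - b.val = m - d.val → a.val + (n - b.val) = k →
      (Set.range fun v : {v // v ∉ geodClosure (pathGraph n) ↑S} =>
        grundy (pathGraph n) (insert v.1 S)) ⊆
      Set.range fun v : {v // v ∉ geodClosure (pathGraph m) ↑T} =>
        grundy (pathGraph m) (insert v.1 T) := by
    rintro n m S T a b c d ha hb hc hd hleft hright hk _ ⟨⟨v, hv⟩, rfl⟩
    have hab : a.val ≤ b.val := ha.2 hb.1
    have hcd : c.val ≤ d.val := hc.2 hd.1
    rw [geodClosure_pathGraph ha hb, Set.mem_Icc, not_and_or, not_le, not_le] at hv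
    rcases hv with hva | hbv
    · have hva' : v.val < a.val := hva
      let w : Fin m := ⟨v.val, by omega⟩
      have hwc : w < c := Fin.lt_def.mpr (by dsimp only [w]; omega)
      refine ⟨⟨w, ?_⟩, ih (v.val + (n - b.val)) (by omega) (a := w) (b := d) (c := v) (d := b)
        ?_ ?_ ?_ ?_ rfl hright.symm (by dsimp only [w]; omega)⟩
      · rw [geodClosure_pathGraph hc hd]
        exact fun h => absurd h.1 hwc.not_ge
      · simpa [min_eq_left hwc.le] using hc.insert w
      · simpa [max_eq_right (hwc.le.trans (hc.2 hd.1))] using hd.insert w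
      · simpa [min_eq_left hva.le] using ha.insert v
      · simpa [max_eq_right (hva.le.trans (ha.2 hb.1))] using hb.insert v
    · have hbv' : b.val < v.val := hbv
      let w : Fin m := ⟨m - (n - v.val), by omega⟩
      have hdw : d < w := Fin.lt_def.mpr (by dsimp only [w]; omega)
      refine ⟨⟨w, ?_⟩, ih (a.val + (n - v.val)) (by omega) (a := c) (b := w) (c := a) (d := v)
        ?_ ?_ ?_ ?_ hleft.symm (by dsimp only [w]; omega) (by dsimp only [w]; omega)⟩
      · rw [geodClosure_pathGraph hc hd]
        exact fun h => absurd h.2 hdw.not_ge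
      · simpa [min_eq_right ((hc.2 hd.1).trans hdw.le)] using hc.insert w
      · simpa [max_eq_left hdw.le] using hd.insert w
      · simpa [min_eq_right ((ha.2 hb.1).trans hbv.le)] using ha.insert v
      · simpa [max_eq_left hbv.le] using hb.insert v
  rw [grundy, grundy]
  exact congrArg mex <| Set.Subset.antisymm
    (options_subset ha hb hc hd hleft hright hk)
    (options_subset hc hd ha hb hleft.symm hright.symm (by omega))

/-- on the path `P n` with vertices `u_1, …, u_n`, for `1 ≤ i < j ≤ n`,
the Closed Geodetic Game position with `u_i, u_j` selected has the same Grundy value as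
the position on `P_{n-(j-i)}` with its `i`-th vertex selected. -/
theorem grundy_path_two_selected (n : ℕ) (hn : 1 ≤ n) (i j : ℕ)
    (hi : 1 ≤ i) (hij : i < j) (hj : j ≤ n) :
    grundy (SimpleGraph.pathGraph n)
        ({⟨i - 1, by omega⟩, ⟨j - 1, by omega⟩} : Finset (Fin n)) =
      grundy (SimpleGraph.pathGraph (n - (j - i)))
        ({⟨i - 1, by omega⟩} : Finset (Fin (n - (j - i)))) := by
  have hle : (⟨i - 1, by omega⟩ : Fin n) ≤ ⟨j - 1, by omega⟩ :=
    Fin.le_def.mpr (by dsimp only; omega)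
  refine grundy_pathGraph_congr (a := ⟨i - 1, by omega⟩) (b := ⟨j - 1, by omega⟩)
    (c := ⟨i - 1, by omega⟩) (d := ⟨i - 1, by omega⟩) ?_ ?_ ?_ ?_ rfl (by dsimp only; omega)
  · simpa [min_eq_left hle] using
      (isLeast_singleton (a := (⟨j - 1, by omega⟩ : Fin n))).insert ⟨i - 1, by omega⟩
  · simpa [max_eq_right hle] using
      (isGreatest_singleton (a := (⟨j - 1, by omega⟩ : Fin n))).insert ⟨i - 1, by omega⟩
  · simp
  · simp
end
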